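/- Let r be a power of p and m = (m_j)_{j≥0} an integer sequence with m_0 = 1 and m_j ≥ 2 for all j ≥ 1. Then the Laurent series ξ(r,m) is a T*-number. -/

import Mathlib

open Polynomial Filter Set
open scoped Classical

noncomputable section

namespace OotoT

variable (Fq : Type) [Field Fq]

/-- We model the field `F_q((T⁻¹))` of Laurent series in `T⁻¹` as `LaurentSeries Fq`,
whose canonical variable `u` plays the role of `T⁻¹`.  Thus `T` itself is `u⁻¹`. -/
def Tel : LaurentSeries Fq := (HahnSeries.single (1 : ℤ) (1 : Fq))⁻¹

/-- The canonical ring embedding `F_q[T] → F_q((T⁻¹))`, sending `T ↦ u⁻¹`. -/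
def ringHomT : Polynomial Fq →+* LaurentSeries Fq :=
  Polynomial.eval₂RingHom (HahnSeries.C : Fq →+* LaurentSeries Fq) (Tel Fq)

/-- The absolute value on `F_q((T⁻¹))`: `|0| = 0` and `|ξ| = q^{-N}` where
`ξ = Σ_{n ≥ N} a_n T^{-n}` with `a_N ≠ 0`; in our model `N` is the order of `ξ`
as a Hahn series in `u = T⁻¹`. -/
def absL (q : ℕ) (ξ : LaurentSeries Fq) : ℝ :=
  if ξ = 0 then 0 else (q : ℝ) ^ (-ξ.order)

/-- Evaluation of a polynomial `P(X) ∈ (F_q[T])[X]` at `ξ ∈ F_q((T⁻¹))`. -/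
def evalP (ξ : LaurentSeries Fq) (P : Polynomial (Polynomial Fq)) : LaurentSeries Fq :=
  Polynomial.eval₂ (ringHomT Fq) ξ P

/-- The height of `P(X) ∈ (F_q[T])[X]`: the maximum of the absolute values of its
coefficients.  A nonzero `c ∈ F_q[T]` has `|c| = q^{deg c}`, so for `P ≠ 0` the height
is `q` raised to the maximal degree of a (nonzero) coefficient of `P`. -/
def heightP (q : ℕ) (P : Polynomial (Polynomial Fq)) : ℝ :=
  if P = 0 then 0 else (q : ℝ) ^ (P.support.sup fun i => (P.coeff i).natDegree)

/-- `w_n(ξ)`: the supremum (in the extended reals) of the real numbers `w` such that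
`0 < |P(ξ)| ≤ H(P)^{-w}` for infinitely many `P(X) ∈ (F_q[T])[X]` of degree at most `n`. -/
def wn (q : ℕ) (n : ℕ) (ξ : LaurentSeries Fq) : EReal :=
  sSup ((fun w : ℝ => (w : EReal)) ''
    {w : ℝ | {P : Polynomial (Polynomial Fq) | P.natDegree ≤ n ∧
      0 < absL Fq q (evalP Fq ξ P) ∧
      absL Fq q (evalP Fq ξ P) ≤ heightP Fq q P ^ (-w)}.Infinite})

/-- `w(ξ) = limsup_{n→∞} w_n(ξ)/n`. -/
def wB (q : ℕ) (ξ : LaurentSeries Fq) : EReal :=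
  Filter.limsup (fun n : ℕ => wn Fq q n ξ / (n : EReal)) Filter.atTop

/-- `ξ` is an `A`-number if `w(ξ) = 0`. -/
def IsANumber (q : ℕ) (ξ : LaurentSeries Fq) : Prop := wB Fq q ξ = 0

/-- `ξ` is an `S`-number if `0 < w(ξ) < +∞`. -/
def IsSNumber (q : ℕ) (ξ : LaurentSeries Fq) : Prop := 0 < wB Fq q ξ ∧ wB Fq q ξ < ⊤

/-- `ξ` is a `T`-number if `w(ξ) = +∞` and `w_n(ξ) < +∞` for all `n ≥ 1`. -/
def IsTNumber (q : ℕ) (ξ : LaurentSeries Fq) : Prop :=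
  wB Fq q ξ = ⊤ ∧ ∀ n : ℕ, 1 ≤ n → wn Fq q n ξ < ⊤

/-- `ξ` is a `U`-number if `w(ξ) = +∞` and `w_n(ξ) = +∞` for some `n ≥ 1`. -/
def IsUNumber (q : ℕ) (ξ : LaurentSeries Fq) : Prop :=
  wB Fq q ξ = ⊤ ∧ ∃ n : ℕ, 1 ≤ n ∧ wn Fq q n ξ = ⊤

/-- The type `t(ξ) = limsup_{n→∞} (log w_n(ξ))/(log n)` of a `T`-number (as an
extended real; for a `T`-number each `w_n(ξ)` is a finite real, recovered by `toReal`). -/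
def typeT (q : ℕ) (ξ : LaurentSeries Fq) : EReal :=
  Filter.limsup
    (fun n : ℕ => ((Real.log (wn Fq q n ξ).toReal / Real.log n : ℝ) : EReal)) Filter.atTop

/-! ### The algebraic closure side -/

/-- The algebraic closure of `F_q((T⁻¹))`. -/
abbrev AC := AlgebraicClosure (LaurentSeries Fq)

/-- The canonical embedding of `F_q((T⁻¹))` into its algebraic closure. -/
def iota : LaurentSeries Fq →+* AC Fq := algebraMap _ _

/-- The embedding `F_q[T] → AC`. -/
def ringHomTC : Polynomial Fq →+* AC Fq := (iota Fq).comp (ringHomT Fq)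

/-- Evaluation of `P(X) ∈ (F_q[T])[X]` at an element of the algebraic closure. -/
def evalPC (α : AC Fq) (P : Polynomial (Polynomial Fq)) : AC Fq :=
  Polynomial.eval₂ (ringHomTC Fq) α P

/-- `P ∈ (F_q[T])[X]` is *the* minimal polynomial of `α`: it is non-constant, irreducible,
primitive, its leading coefficient is monic (in `T`), and `P(α) = 0`.  For `α` algebraic
over `F_q(T)` such a polynomial exists and is unique. -/
def IsMinPolyOf (α : AC Fq) (P : Polynomial (Polynomial Fq)) : Prop :=
  0 < P.natDegree ∧ Irreducible P ∧ P.IsPrimitive ∧ P.leadingCoeff.Monic ∧ evalPC Fq α P = 0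

/-- `α` is algebraic over `F_q(T)`. -/
def IsAlgT (α : AC Fq) : Prop := ∃ P, IsMinPolyOf Fq α P

/-- The degree of an algebraic `α`: the degree of its minimal polynomial. -/
def degT (α : AC Fq) : ℕ := if h : IsAlgT Fq α then h.choose.natDegree else 0

/-- The height of an algebraic `α`: the height of its minimal polynomial. -/
def heightT (q : ℕ) (α : AC Fq) : ℝ := if h : IsAlgT Fq α then heightP Fq q h.choose else 0

/-- The unique extension of the absolute value to the algebraic closure of `F_q((T⁻¹))`,
given by the standard formula `|x| = |N_{K(x)/K}(x)|^{1/[K(x):K]}`, i.e.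
`|x| = |c₀|^{1/d}` where `c₀` is the constant coefficient and `d` the degree of the
minimal polynomial of `x` over `K = F_q((T⁻¹))`. -/
def absC (q : ℕ) (x : AC Fq) : ℝ :=
  absL Fq q ((minpoly (LaurentSeries Fq) x).coeff 0) ^
    (((minpoly (LaurentSeries Fq) x).natDegree : ℝ)⁻¹)

/-- `w_n^*(ξ)`: the supremum (in the extended reals) of the real numbers `w` such that
`0 < |ξ - α| ≤ H(α)^{-w-1}` for infinitely many `α` algebraic over `F_q(T)` of degree
at most `n`. -/
def wnStar (q : ℕ) (n : ℕ) (ξ : LaurentSeries Fq) : EReal :=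
  sSup ((fun w : ℝ => (w : EReal)) ''
    {w : ℝ | {α : AC Fq | IsAlgT Fq α ∧ degT Fq α ≤ n ∧
      0 < absC Fq q (iota Fq ξ - α) ∧
      absC Fq q (iota Fq ξ - α) ≤ heightT Fq q α ^ (-w - 1)}.Infinite})

/-- `w^*(ξ) = limsup_{n→∞} w_n^*(ξ)/n`. -/
def wBStar (q : ℕ) (ξ : LaurentSeries Fq) : EReal :=
  Filter.limsup (fun n : ℕ => wnStar Fq q n ξ / (n : EReal)) Filter.atTop

/-- `ξ` is an `A*`-number if `w^*(ξ) = 0`. -/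
def IsAStarNumber (q : ℕ) (ξ : LaurentSeries Fq) : Prop := wBStar Fq q ξ = 0

/-- `ξ` is a `T*`-number if `w^*(ξ) = +∞` and `w_n^*(ξ) < +∞` for all `n ≥ 1`. -/
def IsTStarNumber (q : ℕ) (ξ : LaurentSeries Fq) : Prop :=
  wBStar Fq q ξ = ⊤ ∧ ∀ n : ℕ, 1 ≤ n → wnStar Fq q n ξ < ⊤

/-- The `*`-type `t^*(ξ) = limsup_{n→∞} (log w_n^*(ξ))/(log n)` of a `T*`-number. -/
def typeTStar (q : ℕ) (ξ : LaurentSeries Fq) : EReal :=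
  Filter.limsup
    (fun n : ℕ => ((Real.log (wnStar Fq q n ξ).toReal / Real.log n : ℝ) : EReal)) Filter.atTop

/-! ### The Laurent series `ξ(r, m)` -/

/-- `r_j = r^{m_0 m_1 ⋯ m_j}`. -/
def rr (r : ℕ) (m : ℕ → ℕ) (j : ℕ) : ℕ := r ^ (∏ i ∈ Finset.range (j + 1), m i)

/-- `α_j(r, m) = Σ_{n=1}^∞ T^{-r_j^n}`, i.e. the power series in `u = T⁻¹` whose
`k`-th coefficient is `1` exactly when `k = r_j^n` for some `n ≥ 1`. -/
def alphaJ (r : ℕ) (m : ℕ → ℕ) (j : ℕ) : LaurentSeries Fq :=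
  HahnSeries.ofPowerSeries ℤ Fq (PowerSeries.mk fun k =>
    if ∃ n : ℕ, 1 ≤ n ∧ k = rr r m j ^ n then 1 else 0)

/-- `ξ_a(r, m) = Σ_{j=0}^∞ a_j α_j(r, m)`, described coefficientwise: the coefficient of
`T^{-k}` is the (finite) sum over `j` of `a_j` times the coefficient of `T^{-k}` in
`α_j(r, m)`. -/
def xiA (r : ℕ) (m : ℕ → ℕ) (a : ℕ → ℕ) : LaurentSeries Fq :=
  HahnSeries.ofPowerSeries ℤ Fq (PowerSeries.mk fun k =>
    ∑ᶠ j : ℕ, (a j : Fq) * (if ∃ n : ℕ, 1 ≤ n ∧ k = rr r m j ^ n then 1 else 0))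

/-- `ξ(r, m) = Σ_{j=0}^∞ α_j(r, m)`. -/
def xi (r : ℕ) (m : ℕ → ℕ) : LaurentSeries Fq := xiA Fq r m fun _ => 1

/-! ### Algebraicity and algebraic dependence over `F_q(T)` for Laurent series -/

/-- `ξ ∈ F_q((T⁻¹))` is algebraic over `F_q(T)`. -/
def IsAlgLS (ξ : LaurentSeries Fq) : Prop :=
  ∃ P : Polynomial (Polynomial Fq), P ≠ 0 ∧ evalP Fq ξ P = 0

/-- Evaluation of a two-variable polynomial `F(X, Y) ∈ (F_q[T])[X, Y]` (coded as an
iterated polynomial ring, `T` innermost, then `X`, then `Y`) at `(ξ, η)`. -/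
def evalXY (ξ η : LaurentSeries Fq) (F : Polynomial (Polynomial (Polynomial Fq))) :
    LaurentSeries Fq :=
  Polynomial.eval₂ (Polynomial.eval₂RingHom (ringHomT Fq) ξ) η F

/-- `ξ` and `η` are algebraically dependent over `F_q(T)`. -/
def AlgDep (ξ η : LaurentSeries Fq) : Prop :=
  ∃ F : Polynomial (Polynomial (Polynomial Fq)), F ≠ 0 ∧ evalXY Fq ξ η F = 0

/-- `deg_X` of `F(X, Y) ∈ (F_q[T])[X, Y]` in our encoding. -/
def degX (F : Polynomial (Polynomial (Polynomial Fq))) : ℕ :=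
  F.support.sup fun i => (F.coeff i).natDegree

/-- `F(X, Y) ∈ (F_q[T])[X, Y]` is primitive (in `X` and `Y`): no non-unit of `F_q[T]`
divides all of its coefficients. -/
def IsPrimitiveXY (F : Polynomial (Polynomial (Polynomial Fq))) : Prop :=
  ∀ c : Polynomial Fq, (∀ i j : ℕ, c ∣ ((F.coeff i).coeff j)) → IsUnit c

end OotoT

open OotoT

namespace OotoT

section AbsoluteValue

variable {Fq : Type} [Field Fq] {q : ℕ}

lemma absL_zero : absL Fq q 0 = 0 := by simp [absL]

lemma absL_of_ne_zero {x : LaurentSeries Fq} (hx : x ≠ 0) :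
    absL Fq q x = (q : ℝ) ^ (-x.order) := by simp [absL, hx]

lemma absL_nonneg (x : LaurentSeries Fq) : 0 ≤ absL Fq q x := by
  unfold absL; split_ifs <;> positivity

lemma absL_pos (hq : 1 < q) {x : LaurentSeries Fq} (hx : x ≠ 0) : 0 < absL Fq q x := by
  have : (0 : ℝ) < q := by positivity
  rw [absL_of_ne_zero hx]; positivity

lemma absL_mul (hq : 1 < q) (x y : LaurentSeries Fq) :
    absL Fq q (x * y) = absL Fq q x * absL Fq q y := by
  have hq0 : (q : ℝ) ≠ 0 := by positivity
  rcases eq_or_ne x 0 with rfl | hx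
  · simp [absL_zero]
  rcases eq_or_ne y 0 with rfl | hy
  · simp [absL_zero]
  rw [absL_of_ne_zero hx, absL_of_ne_zero hy, absL_of_ne_zero (mul_ne_zero hx hy),
    HahnSeries.order_mul hx hy, ← zpow_add₀ hq0]
  congr 1; ring

/-- A series whose coefficients vanish below `N` has absolute value at most `q ^ (-N)`. -/
lemma absL_le_of_coeff (hq : 1 < q) {x : LaurentSeries Fq} {N : ℤ}
    (h : ∀ i < N, x.coeff i = 0) : absL Fq q x ≤ (q : ℝ) ^ (-N) := by
  have hq1 : (1 : ℝ) ≤ q := by exact_mod_cast hq.le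
  rcases eq_or_ne x 0 with rfl | hx
  · rw [absL_zero]; positivity
  rw [absL_of_ne_zero hx]
  apply zpow_le_zpow_right₀ hq1
  have : N ≤ x.order := (HahnSeries.le_order_iff_forall hx).2 h
  lia

lemma isNonarchimedean_absL (hq : 1 < q) : IsNonarchimedean (absL Fq q) := by
  intro x y
  have hq1 : (1 : ℝ) ≤ q := by exact_mod_cast hq.le
  rcases eq_or_ne x 0 with rfl | hx
  · simp
  rcases eq_or_ne y 0 with rfl | hy
  · simp
  have h := absL_le_of_coeff hq (x := x + y) (N := min x.order y.order) (fun i hi => by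
    rw [HahnSeries.coeff_add, HahnSeries.coeff_eq_zero_of_lt_order (hi.trans_le (min_le_left _ _)),
      HahnSeries.coeff_eq_zero_of_lt_order (hi.trans_le (min_le_right _ _)), add_zero])
  refine h.trans ?_
  rw [absL_of_ne_zero hx, absL_of_ne_zero hy]
  rcases min_choice x.order y.order with h | h <;> rw [h]
  · exact le_max_left _ _
  · exact le_max_right _ _

variable (Fq) in
/-- `absL` as an absolute value. -/
def absV (hq : 1 < q) : AbsoluteValue (LaurentSeries Fq) ℝ where
  toFun := absL Fq q
  map_mul' := absL_mul hq
  nonneg' := absL_nonneg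
  eq_zero' _ := ⟨fun h => by_contra fun hx => (absL_pos hq hx).ne' h, fun h => h ▸ absL_zero⟩
  add_le' x y := (isNonarchimedean_absL hq x y).trans
    (max_le_add_of_nonneg (absL_nonneg x) (absL_nonneg y))

lemma absV_apply (hq : 1 < q) (x : LaurentSeries Fq) : absV Fq hq x = absL Fq q x := rfl

lemma isNonarchimedean_absV (hq : 1 < q) : IsNonarchimedean (absV Fq hq) :=
  isNonarchimedean_absL hq

lemma Tel_pow (i : ℕ) : Tel Fq ^ i = HahnSeries.single (-(i : ℤ)) 1 := by
  rw [Tel, HahnSeries.inv_single, HahnSeries.single_pow]; simp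

lemma Tel_pow_mul_single {i j : ℕ} (c : Fq) :
    Tel Fq ^ i * HahnSeries.single (j : ℤ) c = HahnSeries.single ((j : ℤ) - i) c := by
  rw [Tel_pow, HahnSeries.single_mul_single, one_mul, neg_add_eq_sub]

lemma absL_Tel_pow (i : ℕ) : absL Fq q (Tel Fq ^ i) = (q : ℝ) ^ i := by
  rw [Tel_pow, absL_of_ne_zero (by simp), HahnSeries.order_single one_ne_zero]; simp

lemma ringHomT_X_pow (i : ℕ) : ringHomT Fq (X ^ i) = Tel Fq ^ i := by
  simp [ringHomT]

lemma ringHomT_C (c : Fq) : ringHomT Fq (C c) = HahnSeries.C c := by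
  simp [ringHomT]

lemma absL_ringHomT_le (hq : 1 < q) {p : Fq[X]} {N : ℕ} (hp : p.natDegree ≤ N) :
    absL Fq q (ringHomT Fq p) ≤ (q : ℝ) ^ N := by
  have h : absL Fq q (ringHomT Fq p) ≤ (q : ℝ) ^ (-(-(N : ℤ))) := by
    apply absL_le_of_coeff hq
    intro i hi
    rw [ringHomT, coe_eval₂RingHom, eval₂_eq_sum, Polynomial.sum, HahnSeries.coeff_sum]
    refine Finset.sum_eq_zero fun j hj => ?_
    have := le_natDegree_of_mem_supp j hj
    rw [Tel_pow, HahnSeries.C_apply, HahnSeries.single_mul_single, HahnSeries.coeff_single_of_ne]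
    lia
  simpa using h

lemma absL_ringHomT (hq : 1 < q) {p : Fq[X]} (hp : p ≠ 0) :
    absL Fq q (ringHomT Fq p) = (q : ℝ) ^ p.natDegree := by
  refine le_antisymm (absL_ringHomT_le hq le_rfl) ?_
  have hc : (ringHomT Fq p).coeff (-(p.natDegree : ℤ)) ≠ 0 := by
    rw [ringHomT, coe_eval₂RingHom, eval₂_eq_sum, Polynomial.sum, HahnSeries.coeff_sum,
      Finset.sum_eq_single p.natDegree]
    · rw [Tel_pow, HahnSeries.C_apply, HahnSeries.single_mul_single]
      simpa using hp
    · intro j hj hne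
      rw [Tel_pow, HahnSeries.C_apply, HahnSeries.single_mul_single, HahnSeries.coeff_single_of_ne]
      lia
    · intro h; simp_all
  rw [absL_of_ne_zero (HahnSeries.ne_zero_of_coeff_ne_zero hc), ← zpow_natCast]
  have hq1 : (1 : ℝ) ≤ q := by exact_mod_cast hq.le
  apply zpow_le_zpow_right₀ hq1
  have := HahnSeries.order_le_of_coeff_ne_zero hc
  lia

lemma one_le_absL_ringHomT (hq : 1 < q) {p : Fq[X]} (hp : p ≠ 0) :
    1 ≤ absL Fq q (ringHomT Fq p) := by
  rw [absL_ringHomT hq hp]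
  exact one_le_pow₀ (by exact_mod_cast hq.le)

lemma ringHomT_injective : Function.Injective (ringHomT Fq) := by
  rw [injective_iff_map_eq_zero]
  intro p hp
  by_contra h
  have := one_le_absL_ringHomT (q := 2) one_lt_two h
  rw [hp, absL_zero] at this
  linarith

end AbsoluteValue

section Height

variable {Fq : Type} [Field Fq] {q : ℕ}

/-- The maximal degree of a coefficient. -/
def coeffDegree (P : Fq[X][X]) : ℕ := P.support.sup fun i => (P.coeff i).natDegree

lemma heightP_eq {P : Fq[X][X]} (hP : P ≠ 0) : heightP Fq q P = (q : ℝ) ^ coeffDegree P := by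
  simp [heightP, hP, coeffDegree]

lemma natDegree_coeff_le (P : Fq[X][X]) (i : ℕ) : (P.coeff i).natDegree ≤ coeffDegree P := by
  by_cases hi : i ∈ P.support
  · exact Finset.le_sup (f := fun i => (P.coeff i).natDegree) hi
  · simp [notMem_support_iff.1 hi]

lemma coeffDegree_le {P : Fq[X][X]} {N : ℕ} (h : ∀ i, (P.coeff i).natDegree ≤ N) :
    coeffDegree P ≤ N := Finset.sup_le fun i _ => h i

lemma gaussNorm_map_ringHomT (hq : 1 < q) {P : Fq[X][X]} (hP : P ≠ 0) :
    (P.map (ringHomT Fq)).gaussNorm (absV Fq hq) 1 = (q : ℝ) ^ coeffDegree P := by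
  have hq1 : (1 : ℝ) ≤ q := by exact_mod_cast hq.le
  apply le_antisymm
  · obtain ⟨i, hi⟩ := exists_eq_gaussNorm (absV Fq hq) 1 (P.map (ringHomT Fq))
    rw [hi, coeff_map, one_pow, mul_one, absV_apply]
    exact absL_ringHomT_le hq (natDegree_coeff_le P i)
  · obtain ⟨i, hi, he⟩ := Finset.exists_mem_eq_sup P.support (support_nonempty.2 hP)
      fun i => (P.coeff i).natDegree
    have h := le_gaussNorm (absV Fq hq) (P.map (ringHomT Fq)) zero_le_one i
    rw [coeff_map, one_pow, mul_one, absV_apply, absL_ringHomT hq (mem_support_iff.1 hi)] at h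
    rwa [coeffDegree, he]

lemma coeffDegree_mul {P Q : Fq[X][X]} (hP : P ≠ 0) (hQ : Q ≠ 0) :
    coeffDegree (P * Q) = coeffDegree P + coeffDegree Q := by
  have h := gaussNorm_mul (isNonarchimedean_absV (Fq := Fq) one_lt_two) one_pos
    (P.map (ringHomT Fq)) (Q.map (ringHomT Fq))
  rw [← Polynomial.map_mul, gaussNorm_map_ringHomT _ hP, gaussNorm_map_ringHomT _ hQ,
    gaussNorm_map_ringHomT _ (mul_ne_zero hP hQ), ← pow_add] at h
  exact Nat.pow_right_injective le_rfl (by exact_mod_cast h)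

lemma coeffDegree_le_of_dvd {P Q : Fq[X][X]} (hQ : Q ≠ 0) (h : P ∣ Q) :
    coeffDegree P ≤ coeffDegree Q := by
  obtain ⟨R, rfl⟩ := h
  rw [coeffDegree_mul (left_ne_zero_of_mul hQ) (right_ne_zero_of_mul hQ)]
  exact Nat.le_add_right _ _

end Height

section Resultant

variable {K : Type*} [Field K] {v : AbsoluteValue K ℝ}

lemma apply_sum_le_of_forall (hv : IsNonarchimedean v) {ι : Type*} (s : Finset ι) (f : ι → K)
    {B : ℝ} (hB : 0 ≤ B) (h : ∀ i ∈ s, v (f i) ≤ B) : v (∑ i ∈ s, f i) ≤ B := by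
  rcases s.eq_empty_or_nonempty with rfl | hs
  · simpa using hB
  · exact (IsNonarchimedean.apply_sum_le_sup hv hs).trans (Finset.sup'_le _ _ h)

lemma apply_eval_le (hv : IsNonarchimedean v) {f : K[X]} {x : K} (hx : v x ≤ 1) {B : ℝ}
    (hf : ∀ i, v (f.coeff i) ≤ B) : v (f.eval x) ≤ B := by
  have hB : 0 ≤ B := (v.nonneg _).trans (hf 0)
  rw [eval_eq_sum, Polynomial.sum]
  refine apply_sum_le_of_forall hv _ _ hB fun i _ => ?_
  rw [v.map_mul, v.map_pow]
  calc v (f.coeff i) * v x ^ i ≤ B * 1 := by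
        gcongr
        · exact hf i
        · exact pow_le_one₀ (v.nonneg _) hx
    _ = B := mul_one B

/-- A column-wise bound for determinants with respect to a nonarchimedean absolute value. -/
lemma apply_det_le (hv : IsNonarchimedean v) {ι : Type*} [Fintype ι] [DecidableEq ι]
    (A : Matrix ι ι K) {b : ι → ℝ} (hA : ∀ i j, v (A i j) ≤ b j) : v A.det ≤ ∏ j, b j := by
  have hb (j : ι) : 0 ≤ b j := (v.nonneg _).trans (hA j j)
  rw [Matrix.det_apply]
  refine apply_sum_le_of_forall hv _ _ (Finset.prod_nonneg fun j _ => hb j) fun σ _ => ?_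
  have : v (Equiv.Perm.sign σ • ∏ i, A (σ i) i) = v (∏ i, A (σ i) i) := by
    rcases Int.units_eq_one_or (Equiv.Perm.sign σ) with h | h <;> simp [h]
  rw [this, map_prod]
  exact Finset.prod_le_prod (fun i _ => v.nonneg _) fun i _ => hA _ _

lemma vecMul_sylvester (f g : K[X]) {m n : ℕ} (hf : f.natDegree ≤ m) (hg : g.natDegree ≤ n)
    (x : K) (j : Fin (m + n)) :
    Matrix.vecMul (fun i : Fin (m + n) => x ^ (i : ℕ)) (sylvester f g m n) j =
      Fin.addCases (fun j₁ : Fin m => x ^ (j₁ : ℕ) * g.eval x)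
        (fun j₁ : Fin n => x ^ (j₁ : ℕ) * f.eval x) j := by
  have key (h : K[X]) (a k : ℕ) (hh : h.natDegree ≤ a) (hk : k + a < m + n) :
      ∑ i : Fin (m + n), x ^ (i : ℕ) *
        (if (i : ℕ) ∈ Set.Icc k (k + a) then h.coeff (i - k) else 0) = x ^ k * h.eval x := by
    rw [Fin.sum_univ_eq_sum_range (fun i : ℕ => x ^ i *
        (if i ∈ Set.Icc k (k + a) then h.coeff (i - k) else 0)) (m + n),
      eval_eq_sum_range' (Nat.lt_succ_of_le hh), Finset.mul_sum]
    symm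
    apply Finset.sum_of_injOn (fun i => k + i)
    · intro a _ b _ h; simpa using h
    · intro i hi; simp at hi ⊢; lia
    · intro i hi hni
      have : i ∉ Set.Icc k (k + a) := by
        intro hi'
        simp at hni hi'
        exact hni (i - k) (by lia) (by lia)
      simp [this]
    · intro i hi
      simp at hi
      rw [if_pos (by simp; lia), Nat.add_sub_cancel_left]
      ring
  induction j using Fin.addCases with
  | left j =>
    simp only [Matrix.vecMul, dotProduct, sylvester, Matrix.of_apply, Fin.addCases_left]
    exact key g n j hg (by lia)
  | right j =>
    simp only [Matrix.vecMul, dotProduct, sylvester, Matrix.of_apply, Fin.addCases_right]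
    exact key f m j hf (by lia)

/-- The resultant of `f` and `g` is small if both take small values at an integral point. -/
lemma apply_resultant_le (hv : IsNonarchimedean v) {f g : K[X]} {m n : ℕ}
    (hf : f.natDegree ≤ m) (hg : g.natDegree ≤ n) (hmn : 0 < m + n) {A B : ℝ} (hA : 1 ≤ A)
    (hB : 1 ≤ B) (hfA : ∀ i, v (f.coeff i) ≤ A) (hgB : ∀ i, v (g.coeff i) ≤ B) {x : K}
    (hx : v x ≤ 1) :
    v (f.resultant g m n) ≤ max (v (f.eval x)) (v (g.eval x)) * (A ^ n * B ^ m) := by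
  set S := sylvester f g m n with hS
  let b : Fin (m + n) → ℝ := Fin.addCases (fun _ => B) (fun _ => A)
  have hb1 (j : Fin (m + n)) : 1 ≤ b j := by
    induction j using Fin.addCases <;> simpa [b]
  have hSb (i j : Fin (m + n)) : v (S i j) ≤ b j := by
    induction j using Fin.addCases with
    | left j =>
      simp only [hS, sylvester, Matrix.of_apply, Fin.addCases_left, b]
      split_ifs
      · exact hgB _
      · simp; linarith
    | right j =>
      simp only [hS, sylvester, Matrix.of_apply, Fin.addCases_right, b]
      split_ifs
      · exact hfA _
      · simp; linarith
  have hprod : ∏ j, b j = A ^ n * B ^ m := by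
    rw [Fin.prod_univ_add]; simp [b, mul_comm]
  have hadj (i j : Fin (m + n)) : v (S.adjugate i j) ≤ A ^ n * B ^ m := by
    rw [Matrix.adjugate_apply, ← hprod]
    refine apply_det_le hv _ fun k l => ?_
    rw [Matrix.updateRow_apply]
    split_ifs
    · rw [Pi.single_apply]
      split_ifs
      · simpa using hb1 l
      · simpa using zero_le_one.trans (hb1 l)
    · exact hSb _ _
  have hres := congrFun (congrArg (Matrix.vecMul (fun i : Fin (m + n) => x ^ (i : ℕ)))
    S.mul_adjugate) ⟨0, hmn⟩
  rw [← Matrix.vecMul_vecMul, Matrix.vecMul_smul, Matrix.vecMul_one] at hres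
  simp only [Pi.smul_apply, smul_eq_mul, pow_zero, mul_one] at hres
  rw [resultant, ← hS, ← hres, Matrix.vecMul, dotProduct]
  refine apply_sum_le_of_forall hv _ _ (by positivity) fun j _ => ?_
  rw [v.map_mul]
  refine mul_le_mul ?_ (hadj _ _) (v.nonneg _) (le_max_of_le_left (v.nonneg _))
  rw [vecMul_sylvester f g hf hg]
  have hxp (k : ℕ) : v (x ^ k) ≤ 1 := by rw [v.map_pow]; exact pow_le_one₀ (v.nonneg _) hx
  induction j using Fin.addCases with
  | left j =>
    rw [Fin.addCases_left, v.map_mul]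
    exact (mul_le_of_le_one_left (v.nonneg _) (hxp _)).trans (le_max_right _ _)
  | right j =>
    rw [Fin.addCases_right, v.map_mul]
    exact (mul_le_of_le_one_left (v.nonneg _) (hxp _)).trans (le_max_left _ _)

end Resultant

section Liouville

variable {Fq : Type} [Field Fq] {q : ℕ}

lemma evalP_eq (x : LaurentSeries Fq) (P : Fq[X][X]) :
    evalP Fq x P = (P.map (ringHomT Fq)).eval x := by
  rw [evalP, eval_map]

/-- Liouville's inequality for two coprime polynomials. -/
lemma one_le_of_isCoprime (hq : 1 < q) {P Q : Fq[X][X]} (hP : 0 < P.natDegree)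
    (h : IsCoprime (P.map (algebraMap Fq[X] (FractionRing Fq[X])))
      (Q.map (algebraMap Fq[X] (FractionRing Fq[X])))) {x : LaurentSeries Fq}
    (hx : absL Fq q x ≤ 1) :
    1 ≤ max (absL Fq q (evalP Fq x P)) (absL Fq q (evalP Fq x Q)) *
      (q : ℝ) ^ (coeffDegree P * Q.natDegree + coeffDegree Q * P.natDegree) := by
  have hinj := IsFractionRing.injective Fq[X] (FractionRing Fq[X])
  have hres : P.resultant Q ≠ 0 := by
    intro h0
    have h1 := resultant_map_map P Q P.natDegree Q.natDegree
      (algebraMap Fq[X] (FractionRing Fq[X]))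
    rw [h0, map_zero] at h1
    have h2 : (P.map (algebraMap Fq[X] (FractionRing Fq[X]))).resultant
        (Q.map (algebraMap Fq[X] (FractionRing Fq[X]))) = 0 := by
      rw [natDegree_map_eq_of_injective hinj, natDegree_map_eq_of_injective hinj, h1]
    exact (resultant_eq_zero_iff.1 h2).2 h
  have hq1 : (1 : ℝ) ≤ q := by exact_mod_cast hq.le
  refine (one_le_absL_ringHomT hq hres).trans ?_
  rw [← resultant_map_map, evalP_eq, evalP_eq, pow_add, pow_mul, pow_mul]
  exact apply_resultant_le (isNonarchimedean_absV hq) natDegree_map_le natDegree_map_le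
    (by lia) (one_le_pow₀ hq1) (one_le_pow₀ hq1)
    (fun i => by rw [coeff_map]; exact absL_ringHomT_le hq (natDegree_coeff_le P i))
    (fun i => by rw [coeff_map]; exact absL_ringHomT_le hq (natDegree_coeff_le Q i)) hx

end Liouville

section AlgebraicClosure

variable {Fq : Type} [Field Fq] {q : ℕ}

lemma iota_injective : Function.Injective (iota Fq) := (iota Fq).injective

lemma absC_iota (hq : 1 < q) (x : LaurentSeries Fq) : absC Fq q (iota Fq x) = absL Fq q x := by
  rw [absC, iota, minpoly.eq_X_sub_C]
  simp only [coeff_sub, coeff_X_zero, coeff_C_zero, zero_sub, natDegree_X_sub_C, Nat.cast_one,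
    inv_one, Real.rpow_one]
  exact (absV Fq hq).map_neg x

lemma evalPC_eq (α : AC Fq) (P : Fq[X][X]) :
    evalPC Fq α P = aeval α (P.map (ringHomT Fq)) := by
  rw [evalPC, ringHomTC, aeval_def, eval₂_map, iota]

lemma evalPC_iota (x : LaurentSeries Fq) (P : Fq[X][X]) :
    evalPC Fq (iota Fq x) P = iota Fq (evalP Fq x P) := by
  rw [evalPC, ringHomTC, evalP, hom_eval₂]

/-- `|x - α| ^ e = |g(x)|`, where `g` is the minimal polynomial of `α` over `F_q((T⁻¹))` and `e`
its degree. -/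
lemma absC_sub_pow (hq : 1 < q) (x : LaurentSeries Fq) (α : AC Fq) :
    absC Fq q (iota Fq x - α) ^ (minpoly (LaurentSeries Fq) α).natDegree =
      absL Fq q ((minpoly (LaurentSeries Fq) α).eval x) := by
  have hint : IsIntegral (LaurentSeries Fq) α := Algebra.IsIntegral.isIntegral α
  have hpos := minpoly.natDegree_pos hint
  have habs (k : ℕ) (y : LaurentSeries Fq) : absL Fq q ((-1) ^ k * y) = absL Fq q y := by
    rw [absL_mul hq]
    have := (absV Fq hq).map_pow (-1) k
    rw [absV_apply, absV_apply] at this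
    rw [this]
    have h1 : absL Fq q (-1) = 1 := ((absV Fq hq).map_neg 1).trans (absV Fq hq).map_one
    simp [h1]
  have hm : minpoly (LaurentSeries Fq) (iota Fq x - α) =
      (-1) ^ (minpoly (LaurentSeries Fq) α).natDegree *
        ((minpoly (LaurentSeries Fq) α).comp (X + C x)).comp (-X) := by
    rw [← neg_sub, minpoly.neg, iota, minpoly.sub_algebraMap, natDegree_comp, natDegree_X_add_C,
      mul_one]
  have hd : (minpoly (LaurentSeries Fq) (iota Fq x - α)).natDegree =
      (minpoly (LaurentSeries Fq) α).natDegree := by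
    rw [hm, ← C_1, ← C_neg, ← C_pow, natDegree_C_mul (by simp), natDegree_comp, natDegree_comp]
    simp
  have hc : (minpoly (LaurentSeries Fq) (iota Fq x - α)).coeff 0 =
      (-1) ^ (minpoly (LaurentSeries Fq) α).natDegree *
        (minpoly (LaurentSeries Fq) α).eval x := by
    rw [coeff_zero_eq_eval_zero, hm]
    simp
  rw [absC, hd, hc, habs, Real.rpow_inv_natCast_pow (absL_nonneg _) hpos.ne']

/-- If `P(α) = 0`, then `|P(x)| ≤ H(P) |x - α|` for `|x| ≤ 1` and `|x - α| ≤ 1`. -/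
lemma absL_evalP_le (hq : 1 < q) {P : Fq[X][X]} (hP : P ≠ 0) {α : AC Fq}
    (hα : evalPC Fq α P = 0) {x : LaurentSeries Fq} (hx : absL Fq q x ≤ 1)
    (hxα : absC Fq q (iota Fq x - α) ≤ 1) :
    absL Fq q (evalP Fq x P) ≤ (q : ℝ) ^ coeffDegree P * absC Fq q (iota Fq x - α) := by
  have hint : IsIntegral (LaurentSeries Fq) α := Algebra.IsIntegral.isIntegral α
  have hna := isNonarchimedean_absV (Fq := Fq) hq
  rw [evalPC_eq] at hα
  obtain ⟨h, hh⟩ := minpoly.dvd _ _ hα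
  have hg := gaussNorm_map_ringHomT hq hP
  rw [hh, gaussNorm_mul hna one_pos] at hg
  have hg1 : 1 ≤ (minpoly (LaurentSeries Fq) α).gaussNorm (absV Fq hq) 1 := by
    have := le_gaussNorm (absV Fq hq) (minpoly (LaurentSeries Fq) α) zero_le_one
      (minpoly (LaurentSeries Fq) α).natDegree
    rwa [coeff_natDegree, minpoly.monic hint, map_one, one_pow, mul_one] at this
  have hhn : h.gaussNorm (absV Fq hq) 1 ≤ (q : ℝ) ^ coeffDegree P := by
    rw [← hg]
    exact le_mul_of_one_le_left (h.gaussNorm_nonneg _ zero_le_one) hg1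
  have hhx : absL Fq q (h.eval x) ≤ (q : ℝ) ^ coeffDegree P :=
    apply_eval_le hna hx fun i => by
      have := le_gaussNorm (absV Fq hq) h zero_le_one i
      rw [one_pow, mul_one] at this
      exact this.trans hhn
  have h0 : 0 ≤ absC Fq q (iota Fq x - α) := Real.rpow_nonneg (absL_nonneg _) _
  rw [evalP_eq, hh, eval_mul, absL_mul hq, ← absC_sub_pow hq, mul_comm]
  gcongr
  exact pow_le_of_le_one h0 hxα (minpoly.natDegree_pos hint).ne'

lemma ringHomTC_injective : Function.Injective (ringHomTC Fq) :=
  iota_injective.comp ringHomT_injective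

/-- An irreducible primitive polynomial vanishing at a point divides every polynomial vanishing
there. -/
lemma dvd_of_eval₂_eq_zero {R M : Type*} [CommRing R] [IsDomain R] [NormalizedGCDMonoid R]
    [Field M] {φ : R →+* M} (hφ : Function.Injective φ) {x : M} {P Q : R[X]} (hirr : Irreducible P)
    (hprim : P.IsPrimitive) (hP : P.eval₂ φ x = 0) (hQ : Q.eval₂ φ x = 0) : P ∣ Q := by
  let ψ : FractionRing R →+* M := IsFractionRing.lift hφ
  have hψ : ψ.comp (algebraMap R (FractionRing R)) = φ :=
    RingHom.ext fun y => IsFractionRing.lift_algebraMap hφ y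
  have hev (S : R[X]) : (S.map (algebraMap R (FractionRing R))).eval₂ ψ x = S.eval₂ φ x := by
    rw [eval₂_map, hψ]
  by_contra hdvd
  have hirr' := (IsPrimitive.irreducible_iff_irreducible_map_fraction_map
    (K := FractionRing R) hprim).1 hirr
  obtain ⟨a, b, hab⟩ := (hirr'.coprime_iff_not_dvd (n := Q.map _)).2
    fun h => hdvd (hprim.dvd_of_fraction_map_dvd_fraction_map h)
  have := congrArg (eval₂ ψ x) hab
  simp only [eval₂_add, eval₂_mul, hev, hP, hQ, mul_zero, add_zero, eval₂_one] at this
  exact zero_ne_one this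

/-- An element annihilated by a nonzero polynomial `Q` is algebraic, and its degree and height are
bounded by those of `Q`. -/
lemma isAlgT_of_evalPC_eq_zero (hq : 1 < q) {α : AC Fq} {Q : Fq[X][X]} (hQ : Q ≠ 0)
    (hα : evalPC Fq α Q = 0) :
    IsAlgT Fq α ∧ degT Fq α ≤ Q.natDegree ∧ 1 ≤ heightT Fq q α ∧
      heightT Fq q α ≤ (q : ℝ) ^ coeffDegree Q := by
  have hq1 : (1 : ℝ) ≤ q := by exact_mod_cast hq.le
  have halg : IsAlgT Fq α := by
    have hex : ∃ P : Fq[X][X], Irreducible P ∧ evalPC Fq α P = 0 := by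
      induction Q using WfDvdMonoid.induction_on_irreducible with
      | zero => exact absurd rfl hQ
      | unit u hu =>
        have := hu.map (eval₂RingHom (ringHomTC Fq) α)
        exact absurd hα this.ne_zero
      | mul a i ha hi ih =>
        rw [evalPC, eval₂_mul, mul_eq_zero] at hα
        rcases hα with h | h
        · exact ⟨i, hi, h⟩
        · exact ih ha h
    obtain ⟨P, hP, hPα⟩ := hex
    have hdeg : 0 < P.natDegree := by
      by_contra h
      have h0 : P.natDegree = 0 := by lia
      rw [eq_C_of_natDegree_eq_zero h0, evalPC, eval₂_C] at hPα
      have := (map_eq_zero_iff _ ringHomTC_injective).1 hPα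
      exact hP.ne_zero (by rw [eq_C_of_natDegree_eq_zero h0, this, C_0])
    have hlc : P.leadingCoeff.leadingCoeff ≠ 0 := by simpa using hP.ne_zero
    let u : Fq[X][X] := C (C (P.leadingCoeff.leadingCoeff)⁻¹)
    have hu : IsUnit u := by
      simpa [u, isUnit_C] using hP.ne_zero
    have hirr : Irreducible (u * P) := (irreducible_isUnit_mul hu).2 hP
    have hdeg' : (u * P).natDegree = P.natDegree := natDegree_C_mul (by simpa using hP.ne_zero)
    refine ⟨u * P, by rwa [hdeg'], hirr, hirr.isPrimitive (by rw [hdeg']; exact hdeg.ne'), ?_, ?_⟩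
    · rw [Monic, leadingCoeff_mul, leadingCoeff_C, leadingCoeff_mul, leadingCoeff_C]
      exact inv_mul_cancel₀ hlc
    · have : evalPC Fq α P = 0 := hPα
      rw [evalPC] at this ⊢
      rw [eval₂_mul, this, mul_zero]
  have hspec := halg.choose_spec
  have hdvd := dvd_of_eval₂_eq_zero ringHomTC_injective hspec.2.1 hspec.2.2.1 hspec.2.2.2.2 hα
  refine ⟨halg, ?_, ?_, ?_⟩
  · rw [degT, dif_pos halg]
    exact natDegree_le_of_dvd hdvd hQ
  · rw [heightT, dif_pos halg, heightP_eq hspec.2.1.ne_zero]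
    exact one_le_pow₀ hq1
  · rw [heightT, dif_pos halg, heightP_eq hspec.2.1.ne_zero]
    exact pow_le_pow_right₀ hq1 (coeffDegree_le_of_dvd hQ hdvd)

end AlgebraicClosure

section Lacunary

variable {Fq : Type} [Field Fq] {q : ℕ}

/-- The Laurent series `∑ a_k T^{-r^k}`. -/
def lac (r : ℕ) (a : ℕ → Fq) : LaurentSeries Fq :=
  HahnSeries.ofPowerSeries ℤ Fq (PowerSeries.mk fun n =>
    if r ^ Nat.log r n = n then a (Nat.log r n) else 0)

/-- The sequence `a` shifted to the right by `t`, completed by zeros. -/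
def sh (t : ℕ) (a : ℕ → Fq) (k : ℕ) : Fq := if t ≤ k then a (k - t) else 0

lemma lac_coeff (r : ℕ) (a : ℕ → Fq) (n : ℕ) :
    (lac r a).coeff (n : ℤ) = if r ^ Nat.log r n = n then a (Nat.log r n) else 0 := by
  rw [lac]
  exact (HahnSeries.ofPowerSeries_apply_coeff _ n).trans (PowerSeries.coeff_mk _ _)

lemma lac_coeff_pow {r : ℕ} (hr : 1 < r) (a : ℕ → Fq) (k : ℕ) :
    (lac r a).coeff ((r ^ k : ℕ) : ℤ) = a k := by
  rw [lac_coeff, Nat.log_pow hr, if_pos rfl]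

lemma lac_coeff_neg (r : ℕ) (a : ℕ → Fq) {i : ℤ} (hi : i < 0) : (lac r a).coeff i = 0 := by
  rw [lac, HahnSeries.ofPowerSeries_apply]
  refine HahnSeries.embDomain_of_notMem_range ?_
  rintro ⟨n, hn⟩
  have : (n : ℤ) = i := hn
  omega

lemma lac_sub (r : ℕ) (a b : ℕ → Fq) : lac r a - lac r b = lac r (a - b) := by
  rw [lac, lac, lac, ← map_sub]
  congr 1
  ext n
  simp only [map_sub, PowerSeries.coeff_mk, Pi.sub_apply]
  split_ifs <;> simp

lemma lac_injective {r : ℕ} (hr : 1 < r) {a b : ℕ → Fq} (h : lac r a = lac r b) : a = b := by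
  funext k
  rw [← lac_coeff_pow hr a, h, lac_coeff_pow hr]

lemma absL_lac_le (hq : 1 < q) {r : ℕ} (hr : 1 < r) {a : ℕ → Fq} {L : ℕ}
    (h : ∀ k < L, a k = 0) : absL Fq q (lac r a) ≤ (q : ℝ) ^ (-(r ^ L : ℕ) : ℤ) := by
  refine absL_le_of_coeff hq fun i hi ↦ ?_
  rcases lt_or_ge i 0 with h0 | h0
  · exact lac_coeff_neg r a h0
  · lift i to ℕ using h0
    rw [lac_coeff]
    split_ifs with hn
    · apply h
      rw [← hn] at hi
      exact (Nat.pow_lt_pow_iff_right hr).1 (by exact_mod_cast hi)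
    · rfl

lemma absL_lac_le_one (hq : 1 < q) (r : ℕ) (a : ℕ → Fq) : absL Fq q (lac r a) ≤ 1 := by
  simpa using absL_le_of_coeff (N := 0) hq fun i hi ↦ lac_coeff_neg r a hi

lemma lac_pow {p e : ℕ} (hp : p.Prime) [CharP Fq p] (he : 0 < e) {a : ℕ → Fq}
    (ha : ∀ k, a k ^ p = a k) (t : ℕ) :
    lac (p ^ e) a ^ (p ^ e) ^ t = lac (p ^ e) (sh t a) := by
  have : Fact p.Prime := ⟨hp⟩
  have hr : 1 < p ^ e := Nat.one_lt_pow he.ne' hp.one_lt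
  have hfix (n : ℕ) (k : ℕ) : a k ^ p ^ n = a k := by
    induction n with
    | zero => simp
    | succ n ih => rw [pow_succ, pow_mul, ih, ha]
  rw [lac, lac, ← map_pow, ← pow_mul]
  congr 1
  refine (MvPowerSeries.map_iterateFrobenius_expand p hp.ne_zero _ (e * t)).symm.trans ?_
  ext n
  refine (PowerSeries.coeff_map (iterateFrobenius Fq p (e * t)) n
    (PowerSeries.expand (p ^ (e * t)) (pow_ne_zero _ hp.ne_zero) _)).trans ?_
  rw [PowerSeries.coeff_expand, PowerSeries.coeff_mk]
  generalize hR : p ^ e = r at *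
  have hRt : p ^ (e * t) = r ^ t := by rw [pow_mul, hR]
  rw [hRt]
  have hr0 : 0 < r ^ t := pow_pos (by omega) _
  by_cases hd : r ^ t ∣ n
  · obtain ⟨s, rfl⟩ := hd
    rw [if_pos (dvd_mul_right _ _), Nat.mul_div_cancel_left _ hr0, PowerSeries.coeff_mk]
    rcases Nat.eq_zero_or_pos s with rfl | hs
    · simp
    · have hl : Nat.log r (r ^ t * s) = Nat.log r s + t := by
        clear hRt hfix ha
        induction t with
        | zero => simp
        | succ t ih =>
          rw [pow_succ, mul_right_comm, Nat.log_mul_base hr (by positivity),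
            ih (by positivity)]
          ring
      rw [hl, sh, if_pos (Nat.le_add_left _ _), Nat.add_sub_cancel, pow_add,
        mul_comm (r ^ _) (r ^ t)]
      by_cases h1 : r ^ Nat.log r s = s
      · rw [if_pos h1, if_pos (by rw [h1]), iterateFrobenius_def, hfix]
      · rw [if_neg h1, if_neg (fun h ↦ h1 (Nat.eq_of_mul_eq_mul_left hr0 h)), map_zero]
  · rw [if_neg hd, map_zero, PowerSeries.coeff_mk]
    split_ifs with h1
    · rw [sh, if_neg]
      intro h2
      exact hd (h1 ▸ pow_dvd_pow r h2)
    · rfl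

/-- The polynomial `T^{r^K} (X^d - X - ∑_{k ≤ K} b_k T^{-r^k})`. -/
def artinPoly (r d K : ℕ) (b : ℕ → Fq) : Fq[X][X] :=
  C (X ^ r ^ K) * (X ^ d - X) -
    C (∑ k ∈ Finset.range (K + 1), C (b k) * X ^ (r ^ K - r ^ k))

lemma natDegree_artinPoly {r d K : ℕ} (b : ℕ → Fq) (hd : 1 < d) :
    (artinPoly r d K b).natDegree = d := by
  have h1 : (X ^ d - X : Fq[X][X]).natDegree = d := by
    rw [natDegree_sub_eq_left_of_natDegree_lt, natDegree_X_pow]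
    rwa [natDegree_X_pow, natDegree_X]
  rw [artinPoly, natDegree_sub_C, natDegree_C_mul (pow_ne_zero _ X_ne_zero), h1]

lemma artinPoly_ne_zero {r d K : ℕ} (b : ℕ → Fq) (hd : 1 < d) : artinPoly r d K b ≠ 0 := by
  intro h
  have := natDegree_artinPoly (r := r) (K := K) b hd
  rw [h, natDegree_zero] at this
  omega

lemma coeffDegree_artinPoly_le (r d K : ℕ) (b : ℕ → Fq) :
    coeffDegree (artinPoly r d K b) ≤ r ^ K := by
  have h0 : (∑ k ∈ Finset.range (K + 1), C (b k) * X ^ (r ^ K - r ^ k) : Fq[X]).natDegree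
      ≤ r ^ K := by
    refine natDegree_sum_le_of_forall_le _ _ fun k _ ↦ ?_
    exact (natDegree_C_mul_X_pow_le _ _).trans (Nat.sub_le _ _)
  have hX : (X ^ r ^ K : Fq[X]).natDegree ≤ r ^ K := natDegree_X_pow_le _
  refine coeffDegree_le fun i ↦ ?_
  rw [artinPoly, coeff_sub, coeff_C_mul, coeff_sub, coeff_X_pow, coeff_X, coeff_C]
  refine (natDegree_sub_le_of_le (natDegree_mul_le_of_le hX (n := 0) ?_) (n := r ^ K) ?_).trans
    (by simp)
  · split_ifs <;> simp
  · split_ifs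
    · exact h0
    · simp

lemma evalP_artinPoly {r d : ℕ} (hr : 1 < r) (K : ℕ) {x : LaurentSeries Fq} {b : ℕ → Fq}
    (hx : x ^ d - x = lac r b) :
    evalP Fq x (artinPoly r d K b) = Tel Fq ^ r ^ K * lac r (fun k ↦ if k ≤ K then 0 else b k) := by
  have hsum : lac r (fun k ↦ if k ≤ K then b k else 0) =
      ∑ k ∈ Finset.range (K + 1), HahnSeries.single ((r ^ k : ℕ) : ℤ) (b k) := by
    ext i
    rw [HahnSeries.coeff_sum]
    simp only [HahnSeries.coeff_single]
    rcases lt_or_ge i 0 with h0 | h0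
    · rw [lac_coeff_neg _ _ h0, Finset.sum_eq_zero]
      intro k _
      rw [if_neg]
      intro h
      have : (0 : ℤ) ≤ ((r ^ k : ℕ) : ℤ) := Int.natCast_nonneg _
      omega
    · lift i to ℕ using h0
      rw [lac_coeff]
      simp only [Nat.cast_inj]
      split_ifs with h1 h2
      · rw [Finset.sum_eq_single_of_mem (Nat.log r i) (by simpa [Nat.lt_succ_iff] using h2),
          if_pos h1.symm]
        intro k _ hk
        rw [if_neg]
        intro h
        rw [h, Nat.log_pow hr] at hk
        exact hk rfl
      · rw [Finset.sum_eq_zero]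
        intro k hk
        rw [if_neg]
        intro h
        rw [h, Nat.log_pow hr] at h2
        exact h2 (by simpa [Nat.lt_succ_iff] using hk)
      · rw [Finset.sum_eq_zero]
        intro k hk
        rw [if_neg]
        intro h
        rw [h, Nat.log_pow hr] at h1
        exact h1 rfl
  have hsplit : lac r (fun k ↦ if k ≤ K then 0 else b k) =
      lac r b - lac r (fun k ↦ if k ≤ K then b k else 0) := by
    rw [lac_sub]
    congr 1
    funext k
    simp only [Pi.sub_apply]
    split_ifs <;> simp
  rw [hsplit, mul_sub, hsum, Finset.mul_sum, ← hx, evalP, artinPoly, eval₂_sub, eval₂_mul,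
    eval₂_C, eval₂_C, eval₂_sub, eval₂_pow, eval₂_X, ringHomT_X_pow, map_sum]
  congr 1
  refine Finset.sum_congr rfl fun k hk ↦ ?_
  have hk' : r ^ k ≤ r ^ K := Nat.pow_le_pow_right (by omega) (by simpa [Nat.lt_succ_iff] using hk)
  rw [map_mul, ringHomT_C, ringHomT_X_pow, Tel_pow_mul_single, Tel_pow, HahnSeries.C_apply,
    HahnSeries.single_mul_single, mul_one]
  congr 2
  push_cast [Nat.cast_sub hk']
  ring

lemma absL_evalP_artinPoly_le (hq : 1 < q) {r d K L : ℕ} (hr : 1 < r) {x : LaurentSeries Fq}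
    {b : ℕ → Fq} (hx : x ^ d - x = lac r b) (hb : ∀ k, K < k → k < L → b k = 0) :
    absL Fq q (evalP Fq x (artinPoly r d K b)) ≤
      (q : ℝ) ^ ((r ^ K : ℕ) : ℤ) * (q : ℝ) ^ (-(r ^ L : ℕ) : ℤ) := by
  rw [evalP_artinPoly hr K hx, absL_mul hq, absL_Tel_pow]
  refine mul_le_mul (zpow_natCast _ _).ge (absL_lac_le hq hr fun k hk ↦ ?_) (absL_nonneg _)
    (by positivity)
  split_ifs with h
  · rfl
  · exact hb k (by omega) hk

lemma evalP_artinPoly_eq_zero {r d K : ℕ} (hr : 1 < r) {x : LaurentSeries Fq}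
    {b : ℕ → Fq} (hx : x ^ d - x = lac r b) (hb : ∀ k, K < k → b k = 0) :
    evalP Fq x (artinPoly r d K b) = 0 := by
  rw [evalP_artinPoly hr K hx]
  convert mul_zero _
  ext i
  rw [HahnSeries.coeff_zero]
  rcases lt_or_ge i 0 with h0 | h0
  · exact lac_coeff_neg _ _ h0
  · lift i to ℕ using h0
    rw [lac_coeff]
    split_ifs with h1 h2
    · rfl
    · exact hb _ (by omega)
    · rfl

end Lacunary

section DivisibilityChain

/-- The partial product `m_0 m_1 ⋯ m_j`. -/
def partialProd (m : ℕ → ℕ) (j : ℕ) : ℕ := ∏ i ∈ Finset.range (j + 1), m i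

/-- The number of `j` such that the (positive) integer `s` is divisible by `m_0 m_1 ⋯ m_j`. -/
def divCount (m : ℕ → ℕ) (s : ℕ) : ℕ :=
  ((Finset.range s).filter fun j ↦ partialProd m j ∣ s).card

/-- The number of `j ≤ J` such that `s` is divisible by `m_0 m_1 ⋯ m_j`. -/
def divCountLE (m : ℕ → ℕ) (J s : ℕ) : ℕ :=
  ((Finset.range (J + 1)).filter fun j ↦ partialProd m j ∣ s).card

variable {m : ℕ → ℕ}

lemma partialProd_succ (j : ℕ) : partialProd m (j + 1) = partialProd m j * m (j + 1) :=
  Finset.prod_range_succ _ _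

lemma partialProd_dvd {i j : ℕ} (h : i ≤ j) : partialProd m i ∣ partialProd m j :=
  Finset.prod_dvd_prod_of_subset _ _ _ (Finset.range_mono (by omega))

lemma lt_partialProd (hm0 : m 0 = 1) (hm : ∀ j, 1 ≤ j → 2 ≤ m j) (j : ℕ) :
    j < partialProd m j := by
  induction j with
  | zero => simp [partialProd, hm0]
  | succ j ih =>
    rw [partialProd_succ]
    have := Nat.mul_le_mul_left (partialProd m j) (hm (j + 1) (by omega))
    omega

lemma two_mul_partialProd_le (hm : ∀ j, 1 ≤ j → 2 ≤ m j) (j : ℕ) :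
    2 * partialProd m j ≤ partialProd m (j + 1) := by
  rw [partialProd_succ, mul_comm]
  exact Nat.mul_le_mul_left _ (hm (j + 1) (by omega))

lemma divCount_eq_of_not_dvd (hm0 : m 0 = 1) (hm : ∀ j, 1 ≤ j → 2 ≤ m j) {J s : ℕ}
    (h : ¬ partialProd m (J + 1) ∣ s) : divCount m s = divCountLE m J s := by
  rw [divCount, divCountLE]
  congr 1
  ext j
  simp only [Finset.mem_filter, Finset.mem_range, and_congr_left_iff]
  intro hj
  have hs : 0 < s := Nat.pos_of_ne_zero fun h0 ↦ h (h0 ▸ dvd_zero _)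
  have h1 := lt_partialProd hm0 hm j
  have h2 := Nat.le_of_dvd hs hj
  refine ⟨fun _ ↦ ?_, fun _ ↦ by omega⟩
  by_contra hJ
  exact h ((partialProd_dvd (by omega)).trans hj)

lemma divCountLE_sub {J s : ℕ} (h : partialProd m J ≤ s) :
    divCountLE m J (s - partialProd m J) = divCountLE m J s := by
  rw [divCountLE, divCountLE]
  congr 1
  refine Finset.filter_congr fun j hj ↦ ?_
  have hd : partialProd m j ∣ partialProd m J :=
    partialProd_dvd (by simpa [Nat.lt_succ_iff] using hj)
  conv_rhs => rw [← Nat.sub_add_cancel h]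
  exact (Nat.dvd_add_left hd).symm

lemma divCountLE_of_dvd {J s : ℕ} (h : partialProd m J ∣ s) : divCountLE m J s = J + 1 := by
  rw [divCountLE, Finset.filter_true_of_mem, Finset.card_range]
  intro j hj
  exact (partialProd_dvd (by simpa [Nat.lt_succ_iff] using hj)).trans h

lemma divCount_of_dvd (hm0 : m 0 = 1) (hm : ∀ j, 1 ≤ j → 2 ≤ m j) {J s : ℕ}
    (h : partialProd m J ∣ s) (h' : ¬ partialProd m (J + 1) ∣ s) : divCount m s = J + 1 := by
  rw [divCount_eq_of_not_dvd hm0 hm h', divCountLE_of_dvd h]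

lemma not_dvd_of_lt_of_lt {M i k : ℕ} (h1 : i * M < k) (h2 : k < (i + 1) * M) : ¬ M ∣ k := by
  rintro ⟨c, rfl⟩
  rw [mul_comm i] at h1
  rw [mul_comm (i + 1)] at h2
  have := lt_of_mul_lt_mul_left h1 (Nat.zero_le _)
  have := lt_of_mul_lt_mul_left h2 (Nat.zero_le _)
  omega

lemma divCount_sub_eq (hm0 : m 0 = 1) (hm : ∀ j, 1 ≤ j → 2 ≤ m j) {J i k : ℕ}
    (h1 : i * partialProd m (J + 1) + partialProd m J < k)
    (h2 : k < (i + 1) * partialProd m (J + 1)) :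
    divCount m (k - partialProd m J) = divCount m k := by
  rw [divCount_eq_of_not_dvd hm0 hm (J := J) (not_dvd_of_lt_of_lt (i := i) (by omega) h2),
    divCount_eq_of_not_dvd hm0 hm (J := J) (not_dvd_of_lt_of_lt (i := i) (by omega) (by omega)),
    divCountLE_sub (by omega)]

lemma divCount_mul_partialProd (hm0 : m 0 = 1) (hm : ∀ j, 1 ≤ j → 2 ≤ m j) {J u : ℕ}
    (hu : ¬ m (J + 2) ∣ u) :
    divCount m (u * partialProd m (J + 1)) = J + 2 ∧
      divCount m (u * partialProd m (J + 1) - partialProd m J) = J + 1 := by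
  have hM : 0 < partialProd m (J + 1) := (Nat.zero_le _).trans_lt (lt_partialProd hm0 hm _)
  have ht : 0 < partialProd m J := (Nat.zero_le _).trans_lt (lt_partialProd hm0 hm _)
  have htM := two_mul_partialProd_le hm J
  have hu0 : 0 < u := Nat.pos_of_ne_zero fun h0 ↦ hu (h0 ▸ dvd_zero _)
  have huM := Nat.le_mul_of_pos_left (partialProd m (J + 1)) hu0
  constructor
  · refine divCount_of_dvd hm0 hm (dvd_mul_left _ _) fun h ↦ hu ?_
    rw [partialProd_succ, mul_comm u] at h
    exact Nat.dvd_of_mul_dvd_mul_left hM h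
  · refine divCount_of_dvd hm0 hm (Nat.dvd_sub ?_ dvd_rfl) fun h ↦ ?_
    · exact (partialProd_dvd (by omega)).mul_left _
    · have := (Nat.dvd_sub_iff_right (by omega) (dvd_mul_left _ u)).1 h
      have := Nat.le_of_dvd ht this
      omega

lemma xi_eq_lac {Fq : Type} [Field Fq] {r : ℕ} (hr : 1 < r) (hm0 : m 0 = 1)
    (hm : ∀ j, 1 ≤ j → 2 ≤ m j) : xi Fq r m = lac r fun k ↦ (divCount m k : Fq) := by
  rw [xi, xiA, lac]
  congr 2
  funext k
  simp only [Nat.cast_one, one_mul, rr, ← pow_mul]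
  change ∑ᶠ j, (if ∃ n, 1 ≤ n ∧ k = r ^ (partialProd m j * n) then (1 : Fq) else 0) = _
  split_ifs with hk
  · generalize Nat.log r k = s at hk
    subst hk
    have key (j : ℕ) : (∃ n, 1 ≤ n ∧ r ^ s = r ^ (partialProd m j * n)) ↔
        j ∈ (Finset.range s).filter fun j ↦ partialProd m j ∣ s := by
      have hj := lt_partialProd hm0 hm j
      simp only [Finset.mem_filter, Finset.mem_range]
      constructor
      · rintro ⟨n, hn, h⟩
        have h := Nat.pow_right_injective hr h
        exact ⟨by have := Nat.le_mul_of_pos_right (partialProd m j) hn; omega, n, h⟩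
      · rintro ⟨hjs, n, rfl⟩
        refine ⟨n, Nat.pos_of_ne_zero ?_, rfl⟩
        rintro rfl
        omega
    simp only [key, divCount]
    rw [finsum_eq_sum_of_support_subset (s := Finset.range s)]
    · rw [← Finset.sum_boole]
      refine Finset.sum_congr rfl fun j hj ↦ ?_
      simp only [Finset.mem_filter, hj, true_and]
    · intro j hj
      simp only [Function.mem_support, ne_eq, ite_eq_right_iff, one_ne_zero, imp_false,
        not_not] at hj
      exact Finset.coe_subset.2 (Finset.filter_subset _ _) hj
  · refine finsum_eq_zero_of_forall_eq_zero fun j ↦ if_neg ?_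
    rintro ⟨n, -, rfl⟩
    exact hk (by rw [Nat.log_pow hr])

end DivisibilityChain

section LowerBound

variable {Fq : Type} [Field Fq] {q : ℕ}

lemma natCast_pow_char {p : ℕ} (hp : p.Prime) [CharP Fq p] (n : ℕ) : (n : Fq) ^ p = n := by
  have : Fact p.Prime := ⟨hp⟩
  exact map_natCast (frobenius Fq p) n

lemma lac_pow_sub {p e : ℕ} (hp : p.Prime) [CharP Fq p] (he : 0 < e) (a : ℕ → ℕ) (t : ℕ) :
    lac (p ^ e) (fun k ↦ (a k : Fq)) ^ (p ^ e) ^ t - lac (p ^ e) (fun k ↦ (a k : Fq)) =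
      lac (p ^ e) (sh t (fun k ↦ (a k : Fq)) - fun k ↦ (a k : Fq)) := by
  rw [lac_pow hp he (fun k ↦ natCast_pow_char hp (a k)), lac_sub]

lemma not_dvd_map_artinPoly {r d K₁ K₂ k : ℕ} (hr : 1 < r) {x : LaurentSeries Fq} {b : ℕ → Fq}
    (hx : x ^ d - x = lac r b) (h₁ : K₁ < k) (h₂ : k ≤ K₂) (hb : b k ≠ 0) {P : Fq[X][X]}
    (hP : 0 < P.natDegree)
    (hd₁ : P.map (algebraMap Fq[X] (FractionRing Fq[X])) ∣
      (artinPoly r d K₁ b).map (algebraMap Fq[X] (FractionRing Fq[X]))) :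
    ¬ P.map (algebraMap Fq[X] (FractionRing Fq[X])) ∣
      (artinPoly r d K₂ b).map (algebraMap Fq[X] (FractionRing Fq[X])) := by
  intro hd₂
  obtain ⟨c, hc⟩ : ∃ c : Fq[X], C (X ^ r ^ K₂) * artinPoly r d K₁ b -
      C (X ^ r ^ K₁) * artinPoly r d K₂ b = C c := by
    refine ⟨X ^ r ^ K₁ * (∑ k ∈ Finset.range (K₂ + 1), C (b k) * X ^ (r ^ K₂ - r ^ k)) -
      X ^ r ^ K₂ * (∑ k ∈ Finset.range (K₁ + 1), C (b k) * X ^ (r ^ K₁ - r ^ k)), ?_⟩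
    rw [artinPoly, artinPoly, C_sub, C_mul, C_mul]
    ring
  have hinj := IsFractionRing.injective Fq[X] (FractionRing Fq[X])
  have hc0 : c ≠ 0 := by
    rintro rfl
    have h := congrArg (evalP Fq x) hc
    have hK : lac r (fun k ↦ if k ≤ K₁ then 0 else b k) =
        lac r (fun k ↦ if k ≤ K₂ then 0 else b k) := by
      have hT : Tel Fq ^ (r ^ K₁ + r ^ K₂) ≠ 0 := by
        rw [Tel_pow]
        exact HahnSeries.single_ne_zero one_ne_zero
      refine mul_left_cancel₀ hT (sub_eq_zero.1 ?_)
      have e₁ := evalP_artinPoly hr K₁ hx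
      have e₂ := evalP_artinPoly hr K₂ hx
      rw [evalP] at e₁ e₂
      rw [evalP, evalP, eval₂_sub, eval₂_mul, eval₂_mul, eval₂_C, eval₂_C, ringHomT_X_pow,
        ringHomT_X_pow, e₁, e₂, C_0, eval₂_zero] at h
      rw [← h]
      ring
    have := congrFun (lac_injective hr hK) k
    rw [if_neg (by omega), if_pos h₂] at this
    exact hb this
  have hdvd : P.map (algebraMap Fq[X] (FractionRing Fq[X])) ∣ (C c).map (algebraMap _ _) := by
    rw [← hc, Polynomial.map_sub, Polynomial.map_mul, Polynomial.map_mul]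
    exact dvd_sub (hd₁.mul_left _) (hd₂.mul_left _)
  rw [map_C] at hdvd
  have := natDegree_le_of_dvd hdvd (C_ne_zero.2 ((map_ne_zero_iff _ hinj).2 hc0))
  rw [natDegree_C, natDegree_map_eq_of_injective hinj] at this
  omega

lemma one_le_absL_evalP_mul_of_isCoprime (hq : 1 < q) {P Q : Fq[X][X]} (hP : 0 < P.natDegree)
    (h : IsCoprime (P.map (algebraMap Fq[X] (FractionRing Fq[X])))
      (Q.map (algebraMap Fq[X] (FractionRing Fq[X])))) {x : LaurentSeries Fq}
    (hx : absL Fq q x ≤ 1) {n l L : ℕ} (hn : P.natDegree ≤ n) (hl : coeffDegree Q ≤ l)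
    (hQ : absL Fq q (evalP Fq x Q) ≤ (q : ℝ) ^ (l : ℤ) * (q : ℝ) ^ (-L : ℤ))
    (hL : Q.natDegree * coeffDegree P + n * l + l < L) :
    1 ≤ absL Fq q (evalP Fq x P) * (q : ℝ) ^ (Q.natDegree * coeffDegree P + n * l) := by
  have hq1 : (1 : ℝ) < q := by exact_mod_cast hq
  have hq0 : (0 : ℝ) < q := by positivity
  have hexp : coeffDegree P * Q.natDegree + coeffDegree Q * P.natDegree ≤
      Q.natDegree * coeffDegree P + n * l := by
    rw [mul_comm (coeffDegree P)]
    have := Nat.mul_le_mul hl hn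
    rw [mul_comm l] at this
    omega
  have h1 := (one_le_of_isCoprime hq hP h hx).trans
    (mul_le_mul_of_nonneg_left (pow_le_pow_right₀ hq1.le hexp)
      (le_max_of_le_left (absL_nonneg _)))
  rcases max_choice (absL Fq q (evalP Fq x P)) (absL Fq q (evalP Fq x Q)) with hm | hm
  · rwa [hm] at h1
  · rw [hm] at h1
    exfalso
    have h2 := h1.trans (mul_le_mul_of_nonneg_right hQ (by positivity))
    rw [← zpow_add₀ hq0.ne', ← zpow_natCast, ← zpow_add₀ hq0.ne'] at h2
    refine h2.not_gt (zpow_lt_one_of_neg₀ hq1 ?_)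
    have : ((Q.natDegree * coeffDegree P + n * l : ℕ) : ℤ) + l < L := by exact_mod_cast hL
    linarith

variable {m : ℕ → ℕ}

lemma one_le_absL_evalP_xi_mul {p e : ℕ} (hp : p.Prime) [CharP Fq p] (he : 0 < e) (hq : 1 < q)
    (hm0 : m 0 = 1) (hm : ∀ j, 1 ≤ j → 2 ≤ m j) {n J i : ℕ}
    (hn : n + 2 ≤ (p ^ e) ^ partialProd m J) {P : Fq[X][X]} (hP : 0 < P.natDegree)
    (hPn : P.natDegree ≤ n) (hi : coeffDegree P < ((p ^ e) ^ partialProd m (J + 1)) ^ i)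
    (h : IsCoprime (P.map (algebraMap Fq[X] (FractionRing Fq[X])))
      ((artinPoly (p ^ e) ((p ^ e) ^ partialProd m J)
        (i * partialProd m (J + 1) + partialProd m J)
        (sh (partialProd m J) (fun k ↦ (divCount m k : Fq)) - fun k ↦ (divCount m k : Fq))).map
          (algebraMap Fq[X] (FractionRing Fq[X])))) :
    1 ≤ absL Fq q (evalP Fq (xi Fq (p ^ e) m) P) *
      (q : ℝ) ^ ((p ^ e) ^ partialProd m J * coeffDegree P + n * ((p ^ e) ^ partialProd m J *
        ((p ^ e) ^ partialProd m (J + 1)) ^ i)) := by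
  have hr : 1 < p ^ e := Nat.one_lt_pow he.ne' hp.one_lt
  have hR : ((p ^ e) ^ partialProd m J) ^ 2 ≤ (p ^ e) ^ partialProd m (J + 1) := by
    rw [← pow_mul, mul_comm]
    exact Nat.pow_le_pow_right hr.le (two_mul_partialProd_le hm J)
  have hd : 1 < (p ^ e) ^ partialProd m J := by omega
  have hxd := lac_pow_sub (Fq := Fq) hp he (divCount m) (partialProd m J)
  rw [xi_eq_lac hr hm0 hm]
  generalize hQ : artinPoly (p ^ e) ((p ^ e) ^ partialProd m J)
        (i * partialProd m (J + 1) + partialProd m J)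
        (sh (partialProd m J) (fun k ↦ (divCount m k : Fq)) - fun k ↦ (divCount m k : Fq)) = Q at h
  have hlen : (p ^ e) ^ (i * partialProd m (J + 1) + partialProd m J) =
      (p ^ e) ^ partialProd m J * ((p ^ e) ^ partialProd m (J + 1)) ^ i := by
    rw [pow_add, mul_comm i, pow_mul]
    exact mul_comm _ _
  have hQd : Q.natDegree = (p ^ e) ^ partialProd m J := hQ ▸ natDegree_artinPoly _ hd
  have hQx := absL_evalP_artinPoly_le hq (K := i * partialProd m (J + 1) + partialProd m J)
    (L := (i + 1) * partialProd m (J + 1)) hr hxd (fun k hk hk' ↦ by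
      simp only [Pi.sub_apply, sh]
      rw [if_pos (by omega), divCount_sub_eq hm0 hm hk hk', sub_self])
  rw [hQ] at hQx
  have hlen' : (p ^ e) ^ ((i + 1) * partialProd m (J + 1)) =
      ((p ^ e) ^ partialProd m (J + 1)) ^ i * (p ^ e) ^ partialProd m (J + 1) := by
    rw [mul_comm (i + 1), pow_mul, pow_succ]
  have := one_le_absL_evalP_mul_of_isCoprime hq hP h (absL_lac_le_one hq _ _) hPn
    (hQ ▸ coeffDegree_artinPoly_le _ _ _ _) hQx ?_
  · rwa [hQd, hlen] at this
  · rw [hQd, hlen, hlen']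
    generalize (p ^ e) ^ partialProd m J = d at *
    generalize (p ^ e) ^ partialProd m (J + 1) = R at *
    generalize R ^ i = S at *
    generalize coeffDegree P = c at *
    calc d * c + n * (d * S) + d * S < d * S + n * (d * S) + d * S := by
          gcongr
      _ = S * (d * (n + 2)) := by ring
      _ ≤ S * (d * d) := by gcongr
      _ ≤ S * R := by rw [← sq]; gcongr

lemma exists_one_le_absL_evalP_xi_mul {p e : ℕ} (hp : p.Prime) [CharP Fq p] (he : 0 < e)
    (hq : 1 < q) (hm0 : m 0 = 1) (hm : ∀ j, 1 ≤ j → 2 ≤ m j) (n : ℕ) :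
    ∃ A : ℕ, ∀ P : Fq[X][X], Irreducible P → P.IsPrimitive → 0 < P.natDegree → P.natDegree ≤ n →
      1 ≤ absL Fq q (evalP Fq (xi Fq (p ^ e) m) P) * (q : ℝ) ^ (A * (coeffDegree P + 1)) := by
  have hr : 1 < p ^ e := Nat.one_lt_pow he.ne' hp.one_lt
  obtain ⟨J, hJ⟩ : ∃ J, n + 2 ≤ (p ^ e) ^ partialProd m J :=
    ⟨n + 2, ((lt_partialProd hm0 hm _).trans (Nat.lt_pow_self hr)).le⟩
  have htM := two_mul_partialProd_le hm J
  have hM0 := lt_partialProd hm0 hm (J + 1)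
  have hR : 1 < (p ^ e) ^ partialProd m (J + 1) := Nat.one_lt_pow (by omega) hr
  refine ⟨(p ^ e) ^ partialProd m J + n * ((p ^ e) ^ partialProd m J *
    ((p ^ e) ^ partialProd m (J + 1)) ^ 3), fun P hirr hprim hP hPn ↦ ?_⟩
  have hirr' := (hprim.irreducible_iff_irreducible_map_fraction_map
    (K := FractionRing Fq[X])).1 hirr
  have hq1 : (1 : ℝ) ≤ q := by exact_mod_cast hq.le
  obtain ⟨i, hi, hi'⟩ : ∃ i, coeffDegree P < ((p ^ e) ^ partialProd m (J + 1)) ^ i ∧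
      ((p ^ e) ^ partialProd m (J + 1)) ^ i ≤
        (p ^ e) ^ partialProd m (J + 1) * (coeffDegree P + 1) := by
    refine ⟨Nat.log ((p ^ e) ^ partialProd m (J + 1)) (coeffDegree P + 1) + 1,
      (Nat.lt_succ_self _).trans (Nat.lt_pow_succ_log_self hR _), ?_⟩
    rw [pow_succ']
    exact Nat.mul_le_mul_left _ (Nat.pow_log_le_self _ (by omega))
  have finish (i' : ℕ) (hle : i ≤ i') (hle' : i' ≤ i + 2)
      (hcop : IsCoprime (P.map (algebraMap Fq[X] (FractionRing Fq[X])))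
      ((artinPoly (p ^ e) ((p ^ e) ^ partialProd m J)
        (i' * partialProd m (J + 1) + partialProd m J)
        (sh (partialProd m J) (fun k ↦ (divCount m k : Fq)) - fun k ↦ (divCount m k : Fq))).map
          (algebraMap Fq[X] (FractionRing Fq[X])))) :
      1 ≤ absL Fq q (evalP Fq (xi Fq (p ^ e) m) P) *
        (q : ℝ) ^ (((p ^ e) ^ partialProd m J + n * ((p ^ e) ^ partialProd m J *
          ((p ^ e) ^ partialProd m (J + 1)) ^ 3)) * (coeffDegree P + 1)) := by
    refine (one_le_absL_evalP_xi_mul hp he hq hm0 hm hJ hP hPn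
      (hi.trans_le (Nat.pow_le_pow_right hR.le hle)) hcop).trans
      (mul_le_mul_of_nonneg_left (pow_le_pow_right₀ hq1 ?_) (absL_nonneg _))
    have hRi : ((p ^ e) ^ partialProd m (J + 1)) ^ i' ≤
        ((p ^ e) ^ partialProd m (J + 1)) ^ 3 * (coeffDegree P + 1) := by
      refine (Nat.pow_le_pow_right hR.le hle').trans ?_
      rw [pow_add, pow_succ _ 2, mul_comm, mul_assoc]
      exact Nat.mul_le_mul_left _ hi'
    calc _ ≤ (p ^ e) ^ partialProd m J * (coeffDegree P + 1) + n * ((p ^ e) ^ partialProd m J *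
          (((p ^ e) ^ partialProd m (J + 1)) ^ 3 * (coeffDegree P + 1))) := by
          gcongr
          omega
      _ = _ := by ring
  by_cases hdvd : P.map (algebraMap Fq[X] (FractionRing Fq[X])) ∣
      ((artinPoly (p ^ e) ((p ^ e) ^ partialProd m J)
        (i * partialProd m (J + 1) + partialProd m J)
        (sh (partialProd m J) (fun k ↦ (divCount m k : Fq)) - fun k ↦ (divCount m k : Fq))).map
          (algebraMap Fq[X] (FractionRing Fq[X])))
  · obtain ⟨u, hu, hu', hmu⟩ : ∃ u, i + 1 ≤ u ∧ u ≤ i + 2 ∧ ¬ m (J + 2) ∣ u := by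
      by_cases hmi : m (J + 2) ∣ i + 1
      · refine ⟨i + 2, by omega, le_rfl, fun h ↦ ?_⟩
        have h1 := (Nat.dvd_add_right (c := 1) hmi).1 h
        have := hm (J + 2) (by omega)
        have := Nat.le_of_dvd one_pos h1
        omega
      · exact ⟨i + 1, le_rfl, by omega, hmi⟩
    obtain ⟨hc, hc'⟩ := divCount_mul_partialProd hm0 hm hmu
    have hlo := Nat.mul_le_mul_right (partialProd m (J + 1)) hu
    have hhi := Nat.mul_le_mul_right (partialProd m (J + 1)) hu'
    rw [add_mul, one_mul] at hlo
    refine finish (i + 2) (by omega) le_rfl (hirr'.coprime_iff_not_dvd.2 ?_)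
    refine not_dvd_map_artinPoly hr (lac_pow_sub (Fq := Fq) hp he (divCount m) (partialProd m J))
      (k := u * partialProd m (J + 1)) (by omega) (by omega) ?_ hP hdvd
    simp only [Pi.sub_apply, sh]
    rw [if_pos (by omega), hc, hc']
    push_cast
    intro h
    have : (1 : Fq) = 0 := by linear_combination -h
    exact one_ne_zero this
  · exact finish i le_rfl (by omega) (hirr'.coprime_iff_not_dvd.2 hdvd)

end LowerBound

section UpperBound

variable {Fq : Type} [Field Fq] {q : ℕ}

lemma finite_setOf_coeffDegree_eq_zero [Finite Fq] (n : ℕ) :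
    {P : Fq[X][X] | P.natDegree ≤ n ∧ coeffDegree P = 0}.Finite := by
  refine Set.Finite.of_injOn (f := fun P (i : Fin (n + 1)) ↦ (P.coeff i).coeff 0)
    (t := Set.univ) (fun _ _ ↦ Set.mem_univ _) ?_ Set.finite_univ
  rintro P ⟨hP, hP0⟩ Q ⟨hQ, hQ0⟩ h
  ext i j
  rcases Nat.eq_zero_or_pos j with rfl | hj
  · rcases Nat.lt_or_ge n i with hi | hi
    · rw [coeff_eq_zero_of_natDegree_lt (hP.trans_lt hi),
        coeff_eq_zero_of_natDegree_lt (hQ.trans_lt hi)]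
    · exact congrFun h ⟨i, by omega⟩
  · rw [coeff_eq_zero_of_natDegree_lt ((natDegree_coeff_le P i).trans_lt (hP0 ▸ hj)),
      coeff_eq_zero_of_natDegree_lt ((natDegree_coeff_le Q i).trans_lt (hQ0 ▸ hj))]

lemma finite_setOf_evalPC_eq_zero {P : Fq[X][X]} (hP : P ≠ 0) :
    {α : AC Fq | evalPC Fq α P = 0}.Finite := by
  have hP' : P.map (ringHomTC Fq) ≠ 0 :=
    (Polynomial.map_ne_zero_iff ringHomTC_injective).2 hP
  refine (finite_setOfPred_isRoot hP').subset fun α hα ↦ ?_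
  rw [Set.mem_ofPred_eq, IsRoot, eval_map]
  exact hα

lemma wnStar_lt_top_of_forall [Finite Fq] (hq : 1 < q) {x : LaurentSeries Fq}
    (hx : absL Fq q x ≤ 1) {n A : ℕ}
    (h : ∀ P : Fq[X][X], Irreducible P → P.IsPrimitive → 0 < P.natDegree → P.natDegree ≤ n →
      1 ≤ absL Fq q (evalP Fq x P) * (q : ℝ) ^ (A * (coeffDegree P + 1))) :
    wnStar Fq q n x < ⊤ := by
  have hq1 : (1 : ℝ) < q := by exact_mod_cast hq
  have hq0 : (0 : ℝ) < q := by positivity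
  refine lt_of_le_of_lt (sSup_le ?_) (EReal.coe_lt_top (2 * A : ℝ))
  rintro _ ⟨w, hw, rfl⟩
  rw [EReal.coe_le_coe_iff]
  by_contra! hwA
  refine hw (Set.Finite.subset (s := ⋃ P ∈ {P : Fq[X][X] | P.natDegree ≤ n ∧ coeffDegree P = 0} \
    {0}, {α : AC Fq | evalPC Fq α P = 0}) ?_ ?_)
  · exact (finite_setOf_coeffDegree_eq_zero n).sdiff.biUnion
      fun P hP ↦ finite_setOf_evalPC_eq_zero hP.2
  rintro α ⟨hα, hdeg, hpos, hle⟩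
  obtain ⟨hP, hirr, hprim, -, hroot⟩ := hα.choose_spec
  rw [degT, dif_pos hα] at hdeg
  rw [heightT, dif_pos hα, heightP_eq hirr.ne_zero] at hle
  generalize hα.choose = P at *
  refine Set.mem_biUnion (x := P) ⟨⟨hdeg, ?_⟩, hirr.ne_zero⟩ hroot
  by_contra h0
  have hc : (1 : ℝ) ≤ coeffDegree P := by exact_mod_cast Nat.one_le_iff_ne_zero.2 h0
  have hA : (0 : ℝ) ≤ A := Nat.cast_nonneg _
  rw [← Real.rpow_natCast, ← Real.rpow_mul hq0.le] at hle
  have h1 : absC Fq q (iota Fq x - α) ≤ 1 :=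
    hle.trans (Real.rpow_le_one_of_one_le_of_nonpos hq1.le (by nlinarith))
  have h2 := (h P hirr hprim hP hdeg).trans (mul_le_mul_of_nonneg_right
    ((absL_evalP_le hq hirr.ne_zero hroot hx h1).trans
      (mul_le_mul_of_nonneg_left hle (by positivity))) (by positivity))
  rw [← Real.rpow_natCast, ← Real.rpow_natCast, ← Real.rpow_add hq0, ← Real.rpow_add hq0] at h2
  refine h2.not_gt (Real.rpow_lt_one_of_one_lt_of_neg hq1 ?_)
  push_cast
  nlinarith

end UpperBound

section Approximation

variable {Fq : Type} [Field Fq] {q : ℕ} {m : ℕ → ℕ}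

/-- The sequence agreeing with `divCount m` up to `B` and with `divCountLE m J` beyond `B`. -/
def truncCount (m : ℕ → ℕ) (J B k : ℕ) : ℕ := if k ≤ B then divCount m k else divCountLE m J k

lemma natCast_divCount_eq_truncCount {p : ℕ} (hp : p.Prime) [CharP Fq p] (hm0 : m 0 = 1)
    (hm : ∀ j, 1 ≤ j → 2 ≤ m j) (J : ℕ) {s k : ℕ} (hs : 1 ≤ s)
    (hk : k < partialProd m (J + p * s) + partialProd m (J + 1)) :
    (divCount m k : Fq) =
      truncCount m J (partialProd m (J + p * s) - partialProd m (J + 1)) k := by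
  rw [truncCount]
  split_ifs with hkB
  · rfl
  have hps : 1 ≤ p * s := Nat.mul_pos hp.pos hs
  have hN0 := lt_partialProd hm0 hm (J + p * s)
  have hNN := two_mul_partialProd_le hm (J + p * s)
  by_cases hkN : k = partialProd m (J + p * s)
  · subst hkN
    rw [divCount_of_dvd hm0 hm dvd_rfl fun h ↦ ?_, divCountLE_of_dvd (partialProd_dvd (by omega))]
    · push_cast
      rw [CharP.cast_eq_zero Fq p]
      ring
    · have := Nat.le_of_dvd (by omega) h
      omega
  · congr 1
    obtain ⟨u, hu⟩ : partialProd m (J + 1) ∣ partialProd m (J + p * s) :=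
      partialProd_dvd (by omega)
    rw [mul_comm (partialProd m (J + 1))] at hu
    obtain ⟨v, rfl⟩ : ∃ v, u = v + 1 := by
      refine Nat.exists_eq_succ_of_ne_zero ?_
      rintro rfl
      omega
    have hv := add_mul v 1 (partialProd m (J + 1))
    have hv' := add_mul (v + 1) 1 (partialProd m (J + 1))
    rcases lt_or_gt_of_ne hkN with h | h
    · exact divCount_eq_of_not_dvd hm0 hm (not_dvd_of_lt_of_lt (i := v) (by omega) (by omega))
    · exact divCount_eq_of_not_dvd hm0 hm (not_dvd_of_lt_of_lt (i := v + 1) (by omega) (by omega))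

lemma natCast_divCount_ne_truncCount {p : ℕ} [CharP Fq p] (hm0 : m 0 = 1)
    (hm : ∀ j, 1 ≤ j → 2 ≤ m j) (J s : ℕ) :
    (divCount m (partialProd m (J + p * s + 1)) : Fq) ≠
      truncCount m J (partialProd m (J + p * s) - partialProd m (J + 1))
        (partialProd m (J + p * s + 1)) := by
  have hN0 := lt_partialProd hm0 hm (J + p * s)
  have hNN := two_mul_partialProd_le hm (J + p * s)
  have hNN' := two_mul_partialProd_le hm (J + p * s + 1)
  rw [truncCount, if_neg (by omega), divCountLE_of_dvd (partialProd_dvd (by omega)),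
    divCount_of_dvd hm0 hm dvd_rfl fun h ↦ ?_]
  · push_cast
    rw [CharP.cast_eq_zero Fq p]
    intro h
    have : (1 : Fq) = 0 := by linear_combination h
    exact one_ne_zero this
  · have := Nat.le_of_dvd (by omega) h
    omega

lemma truncCount_sub {J B k : ℕ} (hk : B + partialProd m J < k) :
    truncCount m J B (k - partialProd m J) = truncCount m J B k := by
  rw [truncCount, truncCount, if_neg (by omega), if_neg (by omega), divCountLE_sub (by omega)]

/-- For every `J`, the series `ξ(r, m)` is approximated by algebraic elements of degree at most
`d = r ^ (m_0 ⋯ m_J)` with exponent `d ^ 2`, arbitrarily closely. -/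
lemma exists_algebraic_approximation {p e : ℕ} (hp : p.Prime) [CharP Fq p] (he : 0 < e)
    (hq : 1 < q) (hm0 : m 0 = 1) (hm : ∀ j, 1 ≤ j → 2 ≤ m j) (J s : ℕ) :
    ∃ α : AC Fq, IsAlgT Fq α ∧ degT Fq α ≤ (p ^ e) ^ partialProd m J ∧
      0 < absC Fq q (iota Fq (xi Fq (p ^ e) m) - α) ∧
      absC Fq q (iota Fq (xi Fq (p ^ e) m) - α) ≤
        heightT Fq q α ^ (-(((p ^ e) ^ partialProd m J : ℕ) ^ 2 : ℝ) - 1) ∧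
      absC Fq q (iota Fq (xi Fq (p ^ e) m) - α) ≤ (q : ℝ)⁻¹ ^ s := by
  have hr : 1 < p ^ e := Nat.one_lt_pow he.ne' hp.one_lt
  have hq1 : (1 : ℝ) < q := by exact_mod_cast hq
  have hq0 : (0 : ℝ) < q := by positivity
  have ht0 := lt_partialProd hm0 hm J
  have htM := two_mul_partialProd_le hm J
  have hps : s + 1 ≤ p * (s + 1) := Nat.le_mul_of_pos_left _ hp.pos
  have hMN : partialProd m (J + 1) ≤ partialProd m (J + p * (s + 1)) :=
    Nat.le_of_dvd (by have := lt_partialProd hm0 hm (J + p * (s + 1)); omega)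
      (partialProd_dvd (by omega))
  have hsN := lt_partialProd hm0 hm (J + p * (s + 1))
  have hclose (k : ℕ) (hk : k < partialProd m (J + p * (s + 1)) + partialProd m (J + 1)) :=
    natCast_divCount_eq_truncCount (Fq := Fq) hp hm0 hm J (Nat.le_add_left 1 s) hk
  have hne := natCast_divCount_ne_truncCount (Fq := Fq) (p := p) hm0 hm J (s + 1)
  have hd : 1 < (p ^ e) ^ partialProd m J := Nat.one_lt_pow (by omega) hr
  have hpow := lac_pow_sub (Fq := Fq) hp he (truncCount m J
    (partialProd m (J + p * (s + 1)) - partialProd m (J + 1))) (partialProd m J)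
  generalize partialProd m (J + p * (s + 1)) = N at *
  have hroot := evalP_artinPoly_eq_zero hr (K := N - partialProd m (J + 1) + partialProd m J) hpow
    (fun k hk ↦ by
      simp only [Pi.sub_apply, sh]
      rw [if_pos (by omega), truncCount_sub hk, sub_self])
  obtain ⟨halg, hdeg, hH1, hH⟩ := isAlgT_of_evalPC_eq_zero hq (artinPoly_ne_zero _ hd)
    ((evalPC_iota _ _).trans (by rw [hroot, map_zero]))
  rw [natDegree_artinPoly _ hd] at hdeg
  have hdist := absL_lac_le hq hr (a := (fun k ↦ (divCount m k : Fq)) -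
    fun k ↦ (truncCount m J (N - partialProd m (J + 1)) k : Fq)) (L := N + partialProd m (J + 1))
    fun k hk ↦ sub_eq_zero.2 (hclose k hk)
  refine ⟨_, halg, hdeg, ?_⟩
  rw [← map_sub, absC_iota hq, xi_eq_lac hr hm0 hm, lac_sub]
  refine ⟨absL_pos hq fun h ↦ ?_, hdist.trans ?_, hdist.trans ?_⟩
  · rw [← lac_sub, sub_eq_zero] at h
    exact hne (congrFun (lac_injective hr h) _)
  · have hH' := hH.trans (pow_le_pow_right₀ hq1.le (coeffDegree_artinPoly_le _ _ _ _))
    refine le_trans ?_ (Real.rpow_le_rpow_of_nonpos (by linarith) hH' ?_)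
    · have hexp : (p ^ e) ^ (N - partialProd m (J + 1) + partialProd m J) *
          (((p ^ e) ^ partialProd m J) ^ 2 + 1) ≤ (p ^ e) ^ (N + partialProd m (J + 1)) := by
        calc _ ≤ (p ^ e) ^ (N - partialProd m (J + 1) + partialProd m J) *
              ((p ^ e) ^ partialProd m J) ^ 3 := by
              gcongr
              generalize (p ^ e) ^ partialProd m J = d at hd
              nlinarith [sq_nonneg d]
          _ = (p ^ e) ^ (N - partialProd m (J + 1) + partialProd m J + partialProd m J * 3) := by
              rw [pow_add _ _ (partialProd m J * 3), pow_mul _ _ 3]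
          _ ≤ _ := Nat.pow_le_pow_right hr.le (by omega)
      rw [← Real.rpow_natCast, ← Real.rpow_mul hq0.le, ← Real.rpow_intCast]
      refine Real.rpow_le_rpow_of_exponent_le hq1.le ?_
      have hexp' := (Nat.cast_le (α := ℝ)).2 hexp
      push_cast at hexp' ⊢
      linarith
    · have : (0 : ℝ) ≤ ((p ^ e) ^ partialProd m J : ℕ) ^ 2 := by positivity
      linarith
  · rw [zpow_neg, zpow_natCast, ← inv_pow]
    refine pow_le_pow_of_le_one (by positivity) (inv_le_one_of_one_le₀ hq1.le) ?_
    have := Nat.lt_pow_self (n := N + partialProd m (J + 1)) hr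
    omega

lemma sq_le_wnStar_xi {p e : ℕ} (hp : p.Prime) [CharP Fq p] (he : 0 < e)
    (hq : 1 < q) (hm0 : m 0 = 1) (hm : ∀ j, 1 ≤ j → 2 ≤ m j) (J : ℕ) :
    ((((p ^ e) ^ partialProd m J : ℕ) ^ 2 : ℝ) : EReal) ≤
      wnStar Fq q ((p ^ e) ^ partialProd m J) (xi Fq (p ^ e) m) := by
  refine le_sSup ⟨_, fun hfin ↦ ?_, rfl⟩
  have happrox := exists_algebraic_approximation (Fq := Fq) hp he hq hm0 hm J
  obtain ⟨α₀, h₁, h₂, h₃, h₄, -⟩ := happrox 0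
  obtain ⟨α, hα, hmin⟩ := Set.exists_min_image _
    (fun α ↦ absC Fq q (iota Fq (xi Fq (p ^ e) m) - α)) hfin ⟨α₀, h₁, h₂, h₃, h₄⟩
  have hq1 : (1 : ℝ) < q := by exact_mod_cast hq
  obtain ⟨s, hs⟩ := exists_pow_lt_of_lt_one hα.2.2.1 (inv_lt_one_of_one_lt₀ hq1)
  obtain ⟨β, k₁, k₂, k₃, k₄, k₅⟩ := happrox s
  exact ((hmin β ⟨k₁, k₂, k₃, k₄⟩).trans k₅).not_gt hs

lemma wBStar_xi_eq_top {p e : ℕ} (hp : p.Prime) [CharP Fq p] (he : 0 < e)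
    (hq : 1 < q) (hm0 : m 0 = 1) (hm : ∀ j, 1 ≤ j → 2 ≤ m j) :
    wBStar Fq q (xi Fq (p ^ e) m) = ⊤ := by
  have hr : 1 < p ^ e := Nat.one_lt_pow he.ne' hp.one_lt
  have hlarge (J : ℕ) : J < (p ^ e) ^ partialProd m J :=
    (lt_partialProd hm0 hm J).trans (Nat.lt_pow_self hr)
  have key (c : ℕ) : (c : EReal) ≤ wBStar Fq q (xi Fq (p ^ e) m) := by
    refine le_limsup_of_frequently_le (frequently_atTop.2 fun n₀ ↦ ?_)
    have hJ := hlarge (max c n₀)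
    refine ⟨(p ^ e) ^ partialProd m (max c n₀), (le_max_right c n₀).trans hJ.le, ?_⟩
    have hsq := sq_le_wnStar_xi (Fq := Fq) hp he hq hm0 hm (max c n₀)
    have hc := (le_max_left c n₀).trans hJ.le
    generalize (p ^ e) ^ partialProd m (max c n₀) = d at *
    have hd : 0 < d := by omega
    rw [EReal.le_div_iff_mul_le (by exact_mod_cast hd) (EReal.natCast_ne_top d)]
    refine le_trans ?_ hsq
    have : (c : ℝ) * d ≤ (d : ℝ) ^ 2 := by
      rw [sq]
      gcongr
    exact_mod_cast this
  refine EReal.eq_top_iff_forall_lt _ |>.2 fun y ↦ ?_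
  obtain ⟨c, hc⟩ := exists_nat_gt y
  exact lt_of_lt_of_le (by exact_mod_cast hc) (key c)

end Approximation

end OotoT

/-- For `r` a power of `p` and `m = (m_j)` with `m_0 = 1`, `m_j ≥ 2` for
`j ≥ 1`, the Laurent series `ξ(r, m)` is a `T*`-number. -/
theorem xi_isTStarNumber (p : ℕ) (hp : p.Prime) (q : ℕ) (hq : ∃ e : ℕ, 0 < e ∧ q = p ^ e)
    (Fq : Type) [Field Fq] [Fintype Fq] [CharP Fq p] (hcard : Fintype.card Fq = q)
    (r : ℕ) (hr : ∃ e : ℕ, 0 < e ∧ r = p ^ e)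
    (m : ℕ → ℕ) (hm0 : m 0 = 1) (hm : ∀ j : ℕ, 1 ≤ j → 2 ≤ m j) :
    IsTStarNumber Fq q (xi Fq r m) := by
  obtain ⟨e, he, rfl⟩ := hr
  obtain ⟨e', he', hqe⟩ := hq
  have hq1 : 1 < q := hqe ▸ Nat.one_lt_pow he'.ne' hp.one_lt
  refine ⟨wBStar_xi_eq_top hp he hq1 hm0 hm, fun n _ ↦ ?_⟩
  obtain ⟨A, hA⟩ := exists_one_le_absL_evalP_xi_mul (Fq := Fq) hp he hq1 hm0 hm n
  refine wnStar_lt_top_of_forall hq1 ?_ hA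
  rw [xi_eq_lac (Nat.one_lt_pow he.ne' hp.one_lt) hm0 hm]
  exact absL_lac_le_one hq1 _ _
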